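/- The optimal Q-function satisfies the Bellman optimality equation used as the Q-learning target: for every state s and action a₀, Q*(s, a₀) = R(f(s,a₀), a₀) + γ · ⨆_{a' ∈ A} Q*(f(s,a₀), a'). -/

import Mathlib

/-- The controlled trajectory: `traj f s a 0 = s` and
`traj f s a (t+1) = f (traj f s a t) (a t)`. -/
def traj {S A : Type*} (f : S → A → S) (s : S) (a : ℕ → A) : ℕ → S
  | 0 => s
  | t + 1 => f (traj f s a t) (a t)

/-- The discounted return `G(s, a) = ∑ₜ γ^t R(s_{t+1}, a_t)`. -/
noncomputable def ret {S A : Type*} (f : S → A → S) (R : S → A → ℝ) (γ : ℝ)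
    (s : S) (a : ℕ → A) : ℝ :=
  ∑' t : ℕ, γ ^ t * R (traj f s a (t + 1)) (a t)

/-- The optimal Q-function `Q*(s, a₀) = ⨆ {G(s, a) : a 0 = a₀}`. -/
noncomputable def Qstar {S A : Type*} (f : S → A → S) (R : S → A → ℝ) (γ : ℝ)
    (s : S) (a₀ : A) : ℝ :=
  ⨆ a : {a : ℕ → A // a 0 = a₀}, ret f R γ s (a : ℕ → A)

section DiscountedReturn

variable {S A : Type*} {f : S → A → S} {R : S → A → ℝ} {γ C : ℝ}

lemma traj_succ_eq_traj_tail (f : S → A → S) (s : S) (a : ℕ → A) (t : ℕ) :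
    traj f s a (t + 1) = traj f (f s (a 0)) (fun n => a (n + 1)) t := by
  induction t with
  | zero => rfl
  | succ t ih =>
    rw [traj, ih]
    rfl

lemma abs_discounted_reward_le (hR : ∀ s a, |R s a| ≤ C) (hγ0 : 0 ≤ γ)
    (s : S) (a : ℕ → A) (t : ℕ) :
    |γ ^ t * R (traj f s a (t + 1)) (a t)| ≤ γ ^ t * C := by
  rw [abs_mul, abs_of_nonneg (pow_nonneg hγ0 t)]
  exact mul_le_mul_of_nonneg_left (hR _ _) (pow_nonneg hγ0 t)

lemma summable_discounted_reward (hR : ∀ s a, |R s a| ≤ C) (hγ0 : 0 ≤ γ) (hγ1 : γ < 1)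
    (s : S) (a : ℕ → A) :
    Summable fun t : ℕ => γ ^ t * R (traj f s a (t + 1)) (a t) :=
  .of_norm_bounded ((summable_geometric_of_lt_one hγ0 hγ1).mul_right C)
    (abs_discounted_reward_le hR hγ0 s a)

lemma ret_le (hR : ∀ s a, |R s a| ≤ C) (hγ0 : 0 ≤ γ) (hγ1 : γ < 1) (s : S) (a : ℕ → A) :
    ret f R γ s a ≤ (1 - γ)⁻¹ * C := by
  rw [← tsum_geometric_of_lt_one hγ0 hγ1, ← tsum_mul_right]
  exact (summable_discounted_reward hR hγ0 hγ1 s a).tsum_le_tsum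
    (fun t => (le_abs_self _).trans (abs_discounted_reward_le hR hγ0 s a t))
    ((summable_geometric_of_lt_one hγ0 hγ1).mul_right C)

lemma ret_eq_reward_add (hR : ∀ s a, |R s a| ≤ C) (hγ0 : 0 ≤ γ) (hγ1 : γ < 1)
    (s : S) (a : ℕ → A) :
    ret f R γ s a =
      R (f s (a 0)) (a 0) + γ * ret f R γ (f s (a 0)) (fun n => a (n + 1)) := by
  rw [ret, (summable_discounted_reward hR hγ0 hγ1 s a).tsum_eq_zero_add, ret, ← tsum_mul_left]
  congr 1
  · simp [traj]
  · refine tsum_congr fun t => ?_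
    rw [traj_succ_eq_traj_tail, pow_succ', mul_assoc]

instance nonempty_actionSeq (a₀ : A) : Nonempty {a : ℕ → A // a 0 = a₀} :=
  ⟨⟨fun _ => a₀, rfl⟩⟩

lemma ret_le_Qstar (hR : ∀ s a, |R s a| ≤ C) (hγ0 : 0 ≤ γ) (hγ1 : γ < 1)
    (s : S) (a : ℕ → A) : ret f R γ s a ≤ Qstar f R γ s (a 0) :=
  le_ciSup (f := fun b : {b : ℕ → A // b 0 = a 0} => ret f R γ s b)
    ⟨_, Set.forall_mem_range.2 fun b => ret_le hR hγ0 hγ1 s b⟩ ⟨a, rfl⟩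

lemma Qstar_le_iSup (hR : ∀ s a, |R s a| ≤ C) (hγ0 : 0 ≤ γ) (hγ1 : γ < 1)
    (s : S) (a₀ : A) : Qstar f R γ s a₀ ≤ ⨆ a' : A, Qstar f R γ s a' :=
  le_ciSup (f := Qstar f R γ s)
    ⟨_, Set.forall_mem_range.2 fun _ => ciSup_le fun b => ret_le hR hγ0 hγ1 s b⟩ a₀

end DiscountedReturn

/-- The optimal Q-function satisfies the Bellman optimality
equation used as the Q-learning target:
`Q*(s, a₀) = R(f(s,a₀), a₀) + γ ⨆_{a'} Q*(f(s,a₀), a')`. -/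
theorem bellman_optimality_Q {S A : Type*} [Nonempty A]
    (f : S → A → S) (R : S → A → ℝ) (γ C : ℝ)
    (hC : 0 ≤ C) (hR : ∀ s a, |R s a| ≤ C)
    (hγ0 : 0 ≤ γ) (hγ1 : γ < 1) (s : S) (a₀ : A) :
    Qstar f R γ s a₀ = R (f s a₀) a₀ + γ * ⨆ a' : A, Qstar f R γ (f s a₀) a' := by
  apply le_antisymm
  · refine ciSup_le ?_
    rintro ⟨a, rfl⟩
    rw [ret_eq_reward_add hR hγ0 hγ1]
    gcongr
    exact (ret_le_Qstar hR hγ0 hγ1 _ _).trans (Qstar_le_iSup hR hγ0 hγ1 _ _)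
  · rw [← le_sub_iff_add_le', Real.mul_iSup_of_nonneg hγ0]
    refine ciSup_le fun a' => ?_
    rw [Qstar, Real.mul_iSup_of_nonneg hγ0]
    refine ciSup_le fun b => ?_
    let a : ℕ → A := fun n => Nat.casesOn n a₀ b.1
    have h := ret_le_Qstar (f := f) hR hγ0 hγ1 s a
    rw [ret_eq_reward_add hR hγ0 hγ1] at h
    exact le_sub_iff_add_le'.2 h
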